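/- Let h > 0 be real and let p ∈ ℝ satisfy 0 < p < 2π, so that sin(p/2) > 0. Define the real number u(p) = (1/2)·cot(p/2)·√(1 + 16·h²·sin²(p/2)) and the complex numbers x^±(p) = (1/h)·e^{±i·p/2}·(1 + √(1 + 16·h²·sin²(p/2)))/(4·sin(p/2)). Then x^±(p) ≠ 0 and x^±(p) + 1/x^±(p) = (u(p) ± i/2)/h. -/

import Mathlib

/-- The rapidity `u(p) = (1/2)·cot(p/2)·√(1 + 16h²·sin²(p/2))`. -/
noncomputable def rapidity (h p : ℝ) : ℝ :=
  (1 / 2) * Real.cot (p / 2) * Real.sqrt (1 + 16 * h ^ 2 * Real.sin (p / 2) ^ 2)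

/-- The deformed spectral parameter
`x^±(p) = (1/h)·e^{±i·p/2}·(1 + √(1 + 16h²·sin²(p/2)))/(4·sin(p/2))`,
with the sign `ε = ±1` of the exponent as a parameter. -/
noncomputable def spectralX (ε : ℝ) (h p : ℝ) : ℂ :=
  (1 / (h : ℂ)) * Complex.exp ((ε : ℂ) * Complex.I * (p : ℂ) / 2) *
    (1 + (Real.sqrt (1 + 16 * h ^ 2 * Real.sin (p / 2) ^ 2) : ℂ)) /
    (4 * (Real.sin (p / 2) : ℂ))

/-- Euler's formula for the phase `e^{±i·p/2}`. -/
lemma exp_sign_mul_I_half {ε : ℝ} (hε : ε = 1 ∨ ε = -1) (p : ℝ) :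
    Complex.exp ((ε : ℂ) * Complex.I * (p : ℂ) / 2)
      = (Real.cos (p / 2) : ℂ) + ε * (Real.sin (p / 2) : ℂ) * Complex.I := by
  have harg : (ε : ℂ) * Complex.I * (p : ℂ) / 2 = ((ε * (p / 2) : ℝ) : ℂ) * Complex.I := by
    push_cast
    ring
  rw [harg, Complex.exp_mul_I, ← Complex.ofReal_cos, ← Complex.ofReal_sin]
  rcases hε with rfl | rfl <;> simp

/-- Both signs of `x^± ≠ 0` and `x^± + 1/x^± = (u ± i/2)/h`, given `sin(p/2) > 0`. -/
lemma spectralX_ne_zero_and_add_inv {ε h p : ℝ} (hε : ε = 1 ∨ ε = -1) (hh : 0 < h)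
    (hs : 0 < Real.sin (p / 2)) :
    spectralX ε h p ≠ 0 ∧
    spectralX ε h p + 1 / spectralX ε h p
      = ((rapidity h p : ℂ) + ε * (Complex.I / 2)) / (h : ℂ) := by
  have hε2 : (ε : ℂ) ^ 2 = 1 := by rcases hε with rfl | rfl <;> simp
  have hcs : (Real.sin (p / 2) : ℂ) ^ 2 + (Real.cos (p / 2) : ℂ) ^ 2 = 1 := by
    exact_mod_cast Real.sin_sq_add_cos_sq (p / 2)
  have hR : (Real.sqrt (1 + 16 * h ^ 2 * Real.sin (p / 2) ^ 2) : ℂ) ^ 2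
      = 1 + 16 * (h : ℂ) ^ 2 * (Real.sin (p / 2) : ℂ) ^ 2 := by
    exact_mod_cast Real.sq_sqrt (by positivity : 0 ≤ 1 + 16 * h ^ 2 * Real.sin (p / 2) ^ 2)
  have hexp := exp_sign_mul_I_half hε p
  have hs0 : (Real.sin (p / 2) : ℂ) ≠ 0 := by exact_mod_cast hs.ne'
  have hh0 : (h : ℂ) ≠ 0 := by exact_mod_cast hh.ne'
  unfold spectralX rapidity
  rw [hexp, Real.cot_eq_cos_div_sin]
  simp only [Complex.ofReal_mul, Complex.ofReal_div, Complex.ofReal_one, Complex.ofReal_ofNat]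
  generalize (Real.sqrt (1 + 16 * h ^ 2 * Real.sin (p / 2) ^ 2) : ℂ) = R at *
  generalize (Real.sin (p / 2) : ℂ) = s at *
  generalize (Real.cos (p / 2) : ℂ) = c at *
  generalize (ε : ℂ) = e at *
  generalize (h : ℂ) = k at *
  have hprod : 1 / k * (c + e * s * Complex.I) * (1 + R) / (4 * s)
      * ((c - e * s * Complex.I) * (R - 1) / (4 * k * s)) = 1 := by
    have hphase : (c + e * s * Complex.I) * (c - e * s * Complex.I) = 1 := by
      linear_combination hcs + s ^ 2 * hε2 - e ^ 2 * s ^ 2 * Complex.I_sq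
    field_simp
    linear_combination (R ^ 2 - 1) * hphase + hR
  refine ⟨left_ne_zero_of_mul_eq_one hprod, ?_⟩
  rw [← eq_one_div_of_mul_eq_one_right hprod]
  field_simp
  ring

/-- For `h > 0` and `0 < p < 2π` (so `sin(p/2) > 0`), the deformed spectral parameters
satisfy `x^± ≠ 0` and `x^± + 1/x^± = (u(p) ± i/2)/h`. -/
theorem spectral_parameter_relation (h p : ℝ) (hh : 0 < h)
    (hp1 : 0 < p) (hp2 : p < 2 * Real.pi) :
    0 < Real.sin (p / 2) ∧
    spectralX 1 h p ≠ 0 ∧ spectralX (-1) h p ≠ 0 ∧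
    spectralX 1 h p + 1 / spectralX 1 h p
      = ((rapidity h p : ℂ) + Complex.I / 2) / (h : ℂ) ∧
    spectralX (-1) h p + 1 / spectralX (-1) h p
      = ((rapidity h p : ℂ) - Complex.I / 2) / (h : ℂ) := by
  have hs : 0 < Real.sin (p / 2) :=
    Real.sin_pos_of_pos_of_lt_pi (by linarith) (by linarith)
  obtain ⟨hplus, eplus⟩ := spectralX_ne_zero_and_add_inv (Or.inl rfl) hh hs
  obtain ⟨hminus, eminus⟩ := spectralX_ne_zero_and_add_inv (Or.inr rfl) hh hs
  refine ⟨hs, hplus, hminus, ?_, ?_⟩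
  · simpa using eplus
  · simpa [sub_eq_add_neg] using eminus
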